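/- (Pieri rule, elementary case) For every partition λ, every n ≥ 0, and every number of variables N ≥ 1, s_λ · e_n = Σ_ν s_ν in ℤ[x_1,…,x_N], where the sum is over all partitions ν obtained from λ by adding n boxes with no two added boxes in the same row (i.e. λ ⊆ ν, |ν| = |λ| + n, and ν_i − λ_i ≤ 1 for every row index i). -/

import Mathlib

namespace PlethysmSquare

open MvPolynomial Finset

attribute [local instance] Classical.propDecidable

/-- A partition (or any shape) is encoded by its row-length function `ν : ℕ → ℕ`
(`ν i` = length of row `i`, rows indexed from `0`); the cell `(i, j)` belongs to
the Young diagram of `ν` iff `j < ν i`.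

`IsSSYT ν T` says that the filling `T` (entry of cell `(i,j)` is `T i j`; the
entry `k : ℕ` stands for the letter `k + 1`) is a semistandard Young tableau of
shape `ν`: rows weakly increase left to right, columns strictly increase top to
bottom, and all entries outside the diagram are `0`. -/
def IsSSYT (ν : ℕ → ℕ) (T : ℕ → ℕ → ℕ) : Prop :=
  (∀ i j1 j2, j1 ≤ j2 → j2 < ν i → T i j1 ≤ T i j2) ∧
  (∀ i1 i2 j, i1 < i2 → j < ν i1 → j < ν i2 → T i1 j < T i2 j) ∧
  (∀ i j, ν i ≤ j → T i j = 0)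

/-- The number of entries of the filling `T` of the diagram of `ν` equal to `k`. -/
noncomputable def contentCount (ν : ℕ → ℕ) (T : ℕ → ℕ → ℕ) (k : ℕ) : ℕ :=
  Set.ncard {p : ℕ × ℕ | p.2 < ν p.1 ∧ T p.1 p.2 = k}

/-- The Schur polynomial `s_ν` in the `N` variables `x_0, …, x_{N-1}`: the sum,
over all semistandard Young tableaux `T` of shape `ν` with entries in
`{0, …, N-1}`, of the monomial `x^T = ∏_k x_k ^ (number of entries of T equal to k)`.
If `ν` has more than `N` (nonempty) rows there is no such tableau and `s_ν = 0`. -/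
noncomputable def schurPoly (R : Type) [CommRing R] (N : ℕ) (ν : ℕ → ℕ) :
    MvPolynomial (Fin N) R :=
  ∑ᶠ T : ℕ → ℕ → ℕ,
    if IsSSYT ν T ∧ (∀ i j, j < ν i → T i j < N)
    then ∏ k : Fin N, (X k : MvPolynomial (Fin N) R) ^ contentCount ν T (k : ℕ)
    else 0

/-- The Kostka number `K^ν_α`: the number of semistandard Young tableaux of
shape `ν` and content `α` (entries arbitrary, i.e. in all of `ℕ`). -/
noncomputable def kostka (ν : ℕ → ℕ) (α : ℕ → ℕ) : ℕ :=
  Nat.card {T : ℕ → ℕ → ℕ // IsSSYT ν T ∧ ∀ k, contentCount ν T k = α k}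

/-- The conjugate (transposed) partition: `conjPart ν j` is the length of the
`j`-th column of the diagram of `ν`. -/
noncomputable def conjPart (ν : ℕ → ℕ) : ℕ → ℕ := fun j => Set.ncard {i | j < ν i}

/-- `ν` is a partition of `m`: weakly decreasing, finitely many nonzero parts,
and the parts sum to `m`. -/
def IsPartitionOf (m : ℕ) (ν : ℕ → ℕ) : Prop :=
  Antitone ν ∧ (∃ M, ∀ i, M ≤ i → ν i = 0) ∧ (∑ᶠ i, ν i) = m

/-- The cell `(i, j)` lies in the skew diagram `ν / μ`. -/
def InSkew (ν μ : ℕ → ℕ) (p : ℕ × ℕ) : Prop := μ p.1 ≤ p.2 ∧ p.2 < ν p.1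

/-- Semistandard skew tableau of shape `ν / μ`: rows weakly increase, columns
strictly increase, entries outside the skew shape are `0`. -/
def IsSkewSSYT (ν μ : ℕ → ℕ) (T : ℕ → ℕ → ℕ) : Prop :=
  (∀ i j1 j2, j1 ≤ j2 → InSkew ν μ (i, j1) → InSkew ν μ (i, j2) → T i j1 ≤ T i j2) ∧
  (∀ i1 i2 j, i1 < i2 → InSkew ν μ (i1, j) → InSkew ν μ (i2, j) → T i1 j < T i2 j) ∧
  (∀ i j, ¬ InSkew ν μ (i, j) → T i j = 0)

/-- The number of entries equal to `k` of a filling of the skew shape `ν / μ`. -/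
noncomputable def skewContentCount (ν μ : ℕ → ℕ) (T : ℕ → ℕ → ℕ) (k : ℕ) : ℕ :=
  Set.ncard {p : ℕ × ℕ | InSkew ν μ p ∧ T p.1 p.2 = k}

/-- The skew Kostka number `K^{ν/μ}_α`: the number of semistandard skew
tableaux of shape `ν / μ` and content `α`. -/
noncomputable def skewKostka (ν μ : ℕ → ℕ) (α : ℕ → ℕ) : ℕ :=
  Nat.card {T : ℕ → ℕ → ℕ // IsSkewSSYT ν μ T ∧ ∀ k, skewContentCount ν μ T k = α k}

/-- A `λ`-tuple of row tableaux: `t i` (given by `j ↦ t i j`, `j < lam i`) is a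
weakly increasing sequence of length `lam i`; entries outside are `0`. -/
def IsRowTuple (lam : ℕ → ℕ) (t : ℕ → ℕ → ℕ) : Prop :=
  (∀ i j1 j2, j1 ≤ j2 → j2 < lam i → t i j1 ≤ t i j2) ∧ (∀ i j, lam i ≤ j → t i j = 0)

/-- A `λ`-tuple of column tableaux: `t i` is a strictly increasing sequence of
length `lam i`; entries outside are `0`. -/
def IsColTuple (lam : ℕ → ℕ) (t : ℕ → ℕ → ℕ) : Prop :=
  (∀ i j1 j2, j1 < j2 → j2 < lam i → t i j1 < t i j2) ∧ (∀ i j, lam i ≤ j → t i j = 0)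

/-- The ring endomorphism `φ` of `R[x_0, …, x_{N-1}]` determined by `x_i ↦ x_i ^ 2`
(so that `φ g` is the plethysm `p_2[g]`). -/
noncomputable def squareVars (R : Type) [CommRing R] (N : ℕ) :
    MvPolynomial (Fin N) R →+* MvPolynomial (Fin N) R :=
  (MvPolynomial.aeval fun i : Fin N => (X i : MvPolynomial (Fin N) R) ^ 2).toRingHom

/-- The symmetric part `s_2[g] = (g² + φ(g))/2` of the square of `g`. -/
noncomputable def s2pleth (N : ℕ) (g : MvPolynomial (Fin N) ℚ) : MvPolynomial (Fin N) ℚ :=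
  ((1 : ℚ) / 2) • (g ^ 2 + squareVars ℚ N g)

/-- The anti-symmetric part `s_{11}[g] = (g² − φ(g))/2` of the square of `g`. -/
noncomputable def s11pleth (N : ℕ) (g : MvPolynomial (Fin N) ℚ) : MvPolynomial (Fin N) ℚ :=
  ((1 : ℚ) / 2) • (g ^ 2 - squareVars ℚ N g)

/-- The two-row shape `(a, b)` (for `b ≤ a`). -/
def twoRow (a b : ℕ) : ℕ → ℕ := fun i => if i = 0 then a else if i = 1 then b else 0

/-- The shape `(2^a, 1^b)`: `a` rows of length `2` followed by `b` rows of length `1`. -/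
def twoOneShape (a b : ℕ) : ℕ → ℕ := fun i => if i < a then 2 else if i < a + b then 1 else 0

/-- The functions `ν` with `a i ≤ ν i ≤ b i` for `i < M` and `ν i = 0` for `M ≤ i`. -/
noncomputable def box (M : ℕ) (a b : ℕ → ℕ) : Finset (ℕ → ℕ) :=
  (Fintype.piFinset fun i : Fin M => Icc (a i) (b i)).image
    fun g i => if h : i < M then g ⟨i, h⟩ else 0

theorem mem_box {M : ℕ} {a b ν : ℕ → ℕ} :
    ν ∈ box M a b ↔ (∀ i, i < M → a i ≤ ν i ∧ ν i ≤ b i) ∧ ∀ i, M ≤ i → ν i = 0 := by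
  simp only [box, mem_image, Fintype.mem_piFinset, mem_Icc]
  constructor
  · rintro ⟨g, hg, rfl⟩
    refine ⟨fun i hi => ?_, fun i hi => ?_⟩
    · simpa [hi] using hg ⟨i, hi⟩
    · simp [Nat.not_lt.mpr hi]
  · rintro ⟨h, h0⟩
    refine ⟨fun i => ν i, fun i => h i i.2, funext fun i => ?_⟩
    by_cases hi : i < M
    · simp [hi]
    · simp [hi, h0 i (Nat.not_lt.mp hi)]

theorem sum_box_prod {R : Type*} [CommRing R] (M : ℕ) (a b : ℕ → ℕ) (f : ℕ → ℕ → R) :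
    ∑ ν ∈ box M a b, ∏ i ∈ range M, f i (ν i) = ∏ i ∈ range M, ∑ k ∈ Icc (a i) (b i), f i k := by
  rw [box, sum_image, prod_range, prod_univ_sum]
  · refine sum_congr rfl fun g _ => ?_
    rw [prod_range]
    simp
  · intro g _ g' _ h
    funext i
    simpa using congrFun h i

/-- The sum over all interlacing sequences of shapes ending in `ν` of the monomials they carry;
this is the Schur polynomial built one variable at a time. -/
noncomputable def interlaceSum {R : Type*} [CommRing R] (x : ℕ → R) : ℕ → (ℕ → ℕ) → R
  | 0, _ => 1
  | N + 1, ν => ∑ μ ∈ box N (fun i => ν (i + 1)) ν,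
      (∏ i ∈ range N, x N ^ (ν i - μ i)) * x N ^ ν N * interlaceSum x N μ

theorem map_interlaceSum {R S : Type*} [CommRing R] [CommRing S] (φ : R →+* S) (x : ℕ → R)
    (N : ℕ) (ν : ℕ → ℕ) :
    φ (interlaceSum x N ν) = interlaceSum (fun i => φ (x i)) N ν := by
  induction N generalizing ν with
  | zero => simp [interlaceSum]
  | succ N ih => simp [interlaceSum, ih]

theorem antitone_of_interlaceSum_ne_zero {R : Type*} [CommRing R] {x : ℕ → R} {N : ℕ}
    {ν : ℕ → ℕ} (h0 : ∀ i, N ≤ i → ν i = 0) (h : interlaceSum x N ν ≠ 0) : Antitone ν := by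
  refine antitone_nat_of_succ_le fun i => ?_
  by_contra! hi
  cases N with
  | zero => simp [h0] at hi
  | succ N =>
    refine h (sum_eq_zero fun μ hμ => ?_)
    have hiN : i < N := by
      by_contra! hN
      rw [h0 (i + 1) (by omega)] at hi
      omega
    have := (mem_box.mp hμ).1 i hiN
    omega

/-- The row-by-row exchange between removing a horizontal strip and adding a vertical one. -/
theorem strip_exchange {R : Type*} [CommRing R] (x t : R) {a b c d : ℕ} (hba : b ≤ a)
    (hdc : d ≤ c) :
    (∑ k ∈ Icc (max b d) (b + 1), t ^ (k - b) * x ^ (k - d)) *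
        ∑ k ∈ Icc (max b (c - 1)) (min a c), x ^ (a - k) * t ^ (c - k) =
      (∑ k ∈ Icc (max a c) (a + 1), t ^ (k - a) * x ^ (k - c)) *
        ∑ k ∈ Icc (max b d) (min (b + 1) c), t ^ (k - b) * x ^ (k - d) := by
  have two (m : ℕ) (f : ℕ → R) : ∑ k ∈ Icc m (m + 1), f k = f m + f (m + 1) := by
    rw [sum_Icc_succ_top (by omega), Icc_self, sum_singleton]
  rcases lt_or_ge c b with hcb | hbc
  · rw [Icc_eq_empty (a := max b (c - 1)) (by omega),
      Icc_eq_empty (b := min (b + 1) c) (by omega)]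
    simp
  rcases lt_or_ge (a + 1) c with hac | hca
  · rw [Icc_eq_empty (b := min a c) (by omega), Icc_eq_empty (a := max a c) (by omega)]
    simp
  rcases hca.eq_or_lt with rfl | hca
  · rw [show max b (a + 1 - 1) = a by omega, show min a (a + 1) = a by omega,
      show max a (a + 1) = a + 1 by omega, show min (b + 1) (a + 1) = b + 1 by omega]
    simp [mul_comm]
  rw [show min a c = c by omega, show max a c = a by omega, two a]
  rcases hbc.eq_or_lt with rfl | hbc
  · rw [show max b (b - 1) = b by omega, show max b d = b by omega,
      show min (b + 1) b = b by omega, two b, Icc_self, sum_singleton, sum_singleton,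
      show a + 1 - b = a - b + 1 by omega, show b + 1 - d = b - d + 1 by omega]
    simp [pow_succ]
    ring
  · obtain ⟨e, rfl⟩ : ∃ e, c = e + 1 := ⟨c - 1, by omega⟩
    rw [show max b (e + 1 - 1) = e by omega, show min (b + 1) (e + 1) = b + 1 by omega, two e,
      show a + 1 - (e + 1) = a - (e + 1) + 1 by omega, show a - e = a - (e + 1) + 1 by omega]
    simp [pow_succ]
    ring

theorem sum_box_strip_exchange {R : Type*} [CommRing R] (x t : R) {lam κ : ℕ → ℕ}
    (hlam : Antitone lam) (hκ : Antitone κ) (m : ℕ) :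
    (∑ k ∈ Icc (max (lam m) (κ m)) (lam m + 1), t ^ (k - lam m) * x ^ (k - κ m)) *
        ∏ i ∈ range m, ∑ k ∈ Icc (max (lam (i + 1)) (κ i - 1)) (min (lam i) (κ i)),
          x ^ (lam i - k) * t ^ (κ i - k) =
      ∏ i ∈ range (m + 1), ∑ k ∈ Icc (max (lam i) (κ i))
          (if i = 0 then lam i + 1 else min (lam i + 1) (κ (i - 1))),
        t ^ (k - lam i) * x ^ (k - κ i) := by
  induction m with
  | zero => simp
  | succ m ih =>
    rw [prod_range_succ, prod_range_succ _ (m + 1), ← ih, mul_comm (∏ i ∈ range m, _), ← mul_assoc,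
      strip_exchange x t (hlam m.le_succ) (hκ m.le_succ)]
    simp
    ring

theorem interlaceSum_mul_prod {R : Type*} [CommRing R] (x : ℕ → R) (t : R) (N : ℕ)
    {lam : ℕ → ℕ} (hlam : Antitone lam) (h0 : ∀ i, N ≤ i → lam i = 0) :
    interlaceSum x N lam * ∏ i ∈ range N, (1 + t * x i) =
      ∑ ν ∈ box N lam (fun i => lam i + 1),
        (∏ i ∈ range N, t ^ (ν i - lam i)) * interlaceSum x N ν := by
  induction N generalizing lam with
  | zero =>
    have : box 0 lam (fun i => lam i + 1) = {fun _ => 0} := by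
      ext ν; simp [mem_box, funext_iff]
    simp [interlaceSum, this]
  | succ N ih =>
    have hμ (μ) (h : μ ∈ box N (fun i => lam (i + 1)) lam) :
        interlaceSum x N μ * ∏ i ∈ range N, (1 + t * x i) =
          ∑ ν ∈ box N μ (fun i => μ i + 1),
            (∏ i ∈ range N, t ^ (ν i - μ i)) * interlaceSum x N ν := by
      rw [mem_box] at h
      refine ih (antitone_nat_of_succ_le fun i => ?_) h.2
      rcases lt_or_ge (i + 1) N with hi | hi
      · exact (h.1 _ hi).2.trans (h.1 i (by omega)).1
      · simp [h.2 _ hi]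
    calc
      _ = ∑ μ ∈ box N (fun i => lam (i + 1)) lam, ∑ κ ∈ box N μ (fun i => μ i + 1),
          (1 + t * x N) * ((∏ i ∈ range N, x N ^ (lam i - μ i)) * x N ^ lam N *
            (∏ i ∈ range N, t ^ (κ i - μ i)) * interlaceSum x N κ) := by
        rw [interlaceSum, sum_mul]
        refine sum_congr rfl fun μ h => ?_
        rw [prod_range_succ, ← mul_assoc, mul_assoc _ (interlaceSum x N μ), hμ μ h, ← mul_sum,
          mul_sum, mul_comm (∑ _ ∈ _, _)]
        simp only [mul_assoc]
      _ = ∑ κ ∈ box N 0 (fun i => lam i + 1),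
          ∑ μ ∈ box N (fun i => max (lam (i + 1)) (κ i - 1)) (fun i => min (lam i) (κ i)),
          (1 + t * x N) * ((∏ i ∈ range N, x N ^ (lam i - μ i)) * x N ^ lam N *
            (∏ i ∈ range N, t ^ (κ i - μ i)) * interlaceSum x N κ) := by
        refine sum_comm' fun μ κ => ?_
        simp only [mem_box, Pi.zero_apply]
        constructor
        · rintro ⟨⟨h1, h2⟩, h3, h4⟩
          refine ⟨⟨fun i hi => ?_, h2⟩, fun i hi => ?_, h4⟩ <;>
          · have := h1 i hi
            have := h3 i hi
            omega
        · rintro ⟨⟨h1, h2⟩, h3, h4⟩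
          refine ⟨⟨fun i hi => ?_, h2⟩, fun i hi => ?_, h4⟩ <;>
          · have := h1 i hi
            have := h3 i hi
            omega
      _ = ∑ κ ∈ box N 0 (fun i => lam i + 1),
          ∑ ν ∈ box (N + 1) (fun i => max (lam i) (κ i))
            (fun i => if i = 0 then lam i + 1 else min (lam i + 1) (κ (i - 1))),
          (∏ i ∈ range (N + 1), t ^ (ν i - lam i)) *
            ((∏ i ∈ range N, x N ^ (ν i - κ i)) * x N ^ ν N * interlaceSum x N κ) := by
        refine sum_congr rfl fun κ hκ => ?_
        by_cases hz : interlaceSum x N κ = 0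
        · simp [hz]
        have hκ0 := (mem_box.mp hκ).2
        have key := sum_box_strip_exchange (x N) t hlam
          (antitone_of_interlaceSum_ne_zero hκ0 hz) N
        rw [← sum_box_prod, ← sum_box_prod (f := fun i k => t ^ (k - lam i) * x N ^ (k - κ i)),
          hκ0 N le_rfl, max_eq_left (Nat.zero_le _), sum_Icc_succ_top (by omega), Icc_self,
          sum_singleton] at key
        calc
          _ = (t ^ (lam N - lam N) * x N ^ (lam N - 0) +
                t ^ (lam N + 1 - lam N) * x N ^ (lam N + 1 - 0)) *
              (∑ μ ∈ box N (fun i => max (lam (i + 1)) (κ i - 1)) (fun i => min (lam i) (κ i)),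
                ∏ i ∈ range N, x N ^ (lam i - μ i) * t ^ (κ i - μ i)) *
              interlaceSum x N κ := by
            rw [mul_sum, sum_mul]
            refine sum_congr rfl fun μ _ => ?_
            rw [prod_mul_distrib]
            simp [pow_succ]
            ring
          _ = _ := by
            rw [key, sum_mul]
            refine sum_congr rfl fun ν _ => ?_
            rw [prod_mul_distrib, prod_range_succ (fun i => x N ^ (ν i - κ i)), hκ0 N le_rfl,
              Nat.sub_zero]
            ring
      _ = _ := by
        simp only [interlaceSum, mul_sum]
        refine sum_comm' fun κ ν => ?_
        simp only [mem_box, Pi.zero_apply]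
        constructor
        · rintro ⟨⟨h1, h2⟩, h3, h4⟩
          refine ⟨⟨fun i hi => ?_, h2⟩, fun i hi => ?_, h4⟩
          · have := h3 (i + 1) (by omega)
            have := h3 i (by omega)
            simp at *
            omega
          · have := h3 i hi
            split_ifs at this <;> omega
        · rintro ⟨⟨h1, h2⟩, h3, h4⟩
          refine ⟨⟨fun i hi => ?_, h2⟩, fun i hi => ?_, h4⟩
          · have := h1 i hi
            have := h3 i (by omega)
            omega
          · have h5 := h3 i hi
            have h6 : κ i ≤ ν i := by
              rcases lt_or_ge i N with h | h
              · exact (h1 i h).2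
              · simp [h2 i h]
            split_ifs with h
            · omega
            · have := (h1 (i - 1) (by omega)).1
              rw [Nat.sub_add_cancel (by omega)] at this
              omega

/-- The semistandard tableaux of shape `ν` with entries less than `N`. -/
def tableaux (N : ℕ) (ν : ℕ → ℕ) : Set (ℕ → ℕ → ℕ) :=
  {T | IsSSYT ν T ∧ ∀ i j, j < ν i → T i j < N}

theorem finite_tableaux (N : ℕ) {ν : ℕ → ℕ} (hν : Antitone ν) {M : ℕ}
    (h0 : ∀ i, M ≤ i → ν i = 0) : (tableaux N ν).Finite := by
  refine (Set.finite_range fun (g : Fin M → Fin (ν 0) → Fin (N + 1)) (i j : ℕ) =>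
    if h : i < M ∧ j < ν 0 then (g ⟨i, h.1⟩ ⟨j, h.2⟩ : ℕ) else 0).subset ?_
  rintro T ⟨⟨-, -, hT0⟩, hTN⟩
  have hle (i j) : T i j < N + 1 := by
    rcases lt_or_ge j (ν i) with h | h
    · exact (hTN i j h).trans N.lt_succ_self
    · simp [hT0 i j h]
  refine ⟨fun i j => ⟨T i j, hle i j⟩, ?_⟩
  funext i j
  by_cases h : i < M ∧ j < ν 0
  · simp [h]
  · refine (dif_neg h).trans (hT0 i j ?_).symm
    by_contra! hj
    refine h ⟨?_, hj.trans_le (hν i.zero_le)⟩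
    by_contra! hi
    simp [h0 i hi] at hj

theorem le_entry {ν : ℕ → ℕ} (hν : Antitone ν) {T : ℕ → ℕ → ℕ} (hT : IsSSYT ν T) {i j : ℕ}
    (hj : j < ν i) : i ≤ T i j := by
  induction i with
  | zero => exact Nat.zero_le _
  | succ i ih =>
    have hj' := hj.trans_le (hν i.le_succ)
    have := hT.2.1 i (i + 1) j i.lt_succ_self hj' hj
    have := ih hj'
    omega

/-- The shape formed by the entries of `T` that are less than `N`. -/
noncomputable def lowerShape (N : ℕ) (ν : ℕ → ℕ) (T : ℕ → ℕ → ℕ) (i : ℕ) : ℕ :=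
  #{j ∈ range (ν i) | T i j < N}

theorem lt_card_filter_range_iff {p : ℕ → Prop} [DecidablePred p] {n j : ℕ}
    (hp : ∀ a b, a ≤ b → b < n → p b → p a) : j < #{a ∈ range n | p a} ↔ j < n ∧ p j := by
  constructor
  · intro h
    by_contra hj
    have : {a ∈ range n | p a} ⊆ range j := by
      intro a ha
      rw [mem_filter, mem_range] at ha
      rw [mem_range]
      by_contra! hja
      exact hj ⟨hja.trans_lt ha.1, hp j a hja ha.1 ha.2⟩
    have := card_le_card this
    rw [card_range] at this
    omega
  · rintro ⟨hj, hpj⟩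
    have : range (j + 1) ⊆ {a ∈ range n | p a} := by
      intro a ha
      rw [mem_range] at ha
      rw [mem_filter, mem_range]
      exact ⟨by omega, hp a j (by omega) hj hpj⟩
    have := card_le_card this
    rw [card_range] at this
    omega

theorem lt_lowerShape_iff {N : ℕ} {ν : ℕ → ℕ} {T : ℕ → ℕ → ℕ} (hT : IsSSYT ν T) {i j : ℕ} :
    j < lowerShape N ν T i ↔ j < ν i ∧ T i j < N :=
  lt_card_filter_range_iff fun a b hab hb h => (hT.1 i a b hab hb).trans_lt h

theorem lowerShape_mem_box {N : ℕ} {ν : ℕ → ℕ} (hν : Antitone ν) {T : ℕ → ℕ → ℕ}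
    (hT : T ∈ tableaux (N + 1) ν) : lowerShape N ν T ∈ box N (fun i => ν (i + 1)) ν := by
  rw [mem_box]
  refine ⟨fun i _ => ⟨?_, ?_⟩, fun i hi => ?_⟩
  · by_contra! h
    have hlt := h.trans_le (hν i.le_succ)
    refine lt_irrefl (lowerShape N ν T i) ((lt_lowerShape_iff hT.1).mpr ⟨hlt, ?_⟩)
    have := hT.1.2.1 i (i + 1) _ i.lt_succ_self hlt h
    have := hT.2 (i + 1) _ h
    omega
  · exact (card_filter_le _ _).trans (card_range _).le
  · by_contra h
    have := (lt_lowerShape_iff hT.1).mp (Nat.pos_of_ne_zero h)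
    have := le_entry hν hT.1 this.1
    omega

/-- The restriction of a filling to the diagram of `μ`. -/
def restrictTo (μ : ℕ → ℕ) (T : ℕ → ℕ → ℕ) (i j : ℕ) : ℕ :=
  if j < μ i then T i j else 0

/-- The extension of a filling of `μ` to the diagram of `ν` by the constant entry `N`. -/
def extendBy (N : ℕ) (μ ν : ℕ → ℕ) (T : ℕ → ℕ → ℕ) (i j : ℕ) : ℕ :=
  if j < μ i then T i j else if j < ν i then N else 0

theorem restrictTo_mem {N : ℕ} {ν : ℕ → ℕ} {T : ℕ → ℕ → ℕ} (hT : IsSSYT ν T) :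
    restrictTo (lowerShape N ν T) T ∈ tableaux N (lowerShape N ν T) := by
  refine ⟨⟨fun i j₁ j₂ hj h => ?_, fun i₁ i₂ j hi h₁ h₂ => ?_, fun i j h => ?_⟩, fun i j h => ?_⟩
  · rw [restrictTo, restrictTo, if_pos h, if_pos (hj.trans_lt h)]
    exact hT.1 i j₁ j₂ hj ((lt_lowerShape_iff hT).mp h).1
  · rw [restrictTo, restrictTo, if_pos h₁, if_pos h₂]
    exact hT.2.1 i₁ i₂ j hi ((lt_lowerShape_iff hT).mp h₁).1 ((lt_lowerShape_iff hT).mp h₂).1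
  · exact if_neg (Nat.not_lt.mpr h)
  · rw [restrictTo, if_pos h]
    exact ((lt_lowerShape_iff hT).mp h).2

theorem le_of_mem_box {N : ℕ} {a ν μ : ℕ → ℕ} (hμ : μ ∈ box N a ν) (i : ℕ) : μ i ≤ ν i := by
  rw [mem_box] at hμ
  rcases lt_or_ge i N with h | h
  · exact (hμ.1 i h).2
  · simp [hμ.2 i h]

theorem antitone_of_mem_box {N : ℕ} {ν μ : ℕ → ℕ} (hμ : μ ∈ box N (fun i => ν (i + 1)) ν) :
    Antitone μ := by
  refine antitone_nat_of_succ_le fun i => ?_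
  rcases lt_or_ge i N with h | h
  · exact (le_of_mem_box hμ (i + 1)).trans ((mem_box.mp hμ).1 i h).1
  · simp [(mem_box.mp hμ).2 (i + 1) (by omega)]

theorem extendBy_mem {N : ℕ} {μ ν : ℕ → ℕ} (hν : Antitone ν) (h0 : ∀ i, N + 1 ≤ i → ν i = 0)
    (hμ : μ ∈ box N (fun i => ν (i + 1)) ν) {T : ℕ → ℕ → ℕ} (hT : T ∈ tableaux N μ) :
    extendBy N μ ν T ∈ tableaux (N + 1) ν := by
  have hle := le_of_mem_box hμ
  have hanti := antitone_of_mem_box hμ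
  refine ⟨⟨fun i j₁ j₂ hj h => ?_, fun i₁ i₂ j hi h₁ h₂ => ?_, fun i j h => ?_⟩, fun i j h => ?_⟩
  · simp only [extendBy, if_pos h, if_pos (hj.trans_lt h)]
    split_ifs with h₁ h₂ h₂
    · exact hT.1.1 i j₁ j₂ hj h₂
    · exact (hT.2 i j₁ h₁).le
    · omega
    · rfl
  · have hlt : j < μ i₁ := by
      have hN : i₁ < N := by
        by_contra! h
        simp [h0 i₂ (by omega)] at h₂
      exact h₂.trans_le ((hν hi).trans ((mem_box.mp hμ).1 i₁ hN).1)
    simp only [extendBy, if_pos h₂, if_pos hlt]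
    split_ifs with h
    · exact hT.1.2.1 i₁ i₂ j hi hlt h
    · exact hT.2 i₁ j hlt
  · rw [extendBy, if_neg (by have := hle i; omega), if_neg (by omega)]
  · simp only [extendBy, if_pos h]
    split_ifs with h'
    · exact (hT.2 i j h').trans N.lt_succ_self
    · exact N.lt_succ_self

theorem lowerShape_extendBy {N : ℕ} {μ ν : ℕ → ℕ} (hle : ∀ i, μ i ≤ ν i) {T : ℕ → ℕ → ℕ}
    (hT : T ∈ tableaux N μ) : lowerShape N ν (extendBy N μ ν T) = μ := by
  funext i
  have : {j ∈ range (ν i) | extendBy N μ ν T i j < N} = range (μ i) := by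
    ext j
    rw [mem_filter, mem_range, mem_range]
    simp only [extendBy]
    constructor
    · rintro ⟨h, h'⟩
      by_contra hj
      simp [hj, h] at h'
    · intro h
      rw [if_pos h]
      exact ⟨h.trans_le (hle i), hT.2 i j h⟩
  rw [lowerShape, this, card_range]

theorem restrictTo_extendBy {N : ℕ} {μ ν : ℕ → ℕ} {T : ℕ → ℕ → ℕ} (hT : IsSSYT μ T) :
    restrictTo μ (extendBy N μ ν T) = T := by
  funext i j
  rw [restrictTo, extendBy]
  split_ifs with h
  · rfl
  · exact (hT.2.2 i j (Nat.not_lt.mp h)).symm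

theorem extendBy_restrictTo {N : ℕ} {ν : ℕ → ℕ} {T : ℕ → ℕ → ℕ} (hT : T ∈ tableaux (N + 1) ν) :
    extendBy N (lowerShape N ν T) ν (restrictTo (lowerShape N ν T) T) = T := by
  funext i j
  rw [extendBy, restrictTo]
  split_ifs with h h'
  · rfl
  · have := hT.2 i j h'
    have := mt (lt_lowerShape_iff (N := N) (j := j) hT.1 (i := i)).mpr h
    omega
  · exact (hT.1.2.2 i j (Nat.not_lt.mp h')).symm

theorem contentCount_extendBy_of_lt {N k : ℕ} {μ ν : ℕ → ℕ} (hle : ∀ i, μ i ≤ ν i)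
    (T : ℕ → ℕ → ℕ) (hk : k < N) :
    contentCount ν (extendBy N μ ν T) k = contentCount μ T k := by
  rw [contentCount, contentCount]
  congr 1
  ext ⟨i, j⟩
  have := hle i
  simp only [Set.mem_ofPred_eq, extendBy]
  split_ifs <;> omega

theorem contentCount_extendBy_self {N : ℕ} {μ ν : ℕ → ℕ} (h0 : ∀ i, N + 1 ≤ i → ν i = 0)
    (hμ : μ ∈ box N (fun i => ν (i + 1)) ν) {T : ℕ → ℕ → ℕ} (hT : T ∈ tableaux N μ) :
    contentCount ν (extendBy N μ ν T) N = ∑ i ∈ range N, (ν i - μ i) + ν N := by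
  have : {p : ℕ × ℕ | p.2 < ν p.1 ∧ extendBy N μ ν T p.1 p.2 = N} =
      (((range (N + 1)).sigma fun i => Ico (μ i) (ν i)).map
        (Equiv.sigmaEquivProd ℕ ℕ).toEmbedding : Finset (ℕ × ℕ)) := by
    ext ⟨i, j⟩
    simp only [Set.mem_ofPred_eq, coe_map, Set.mem_image, mem_coe, mem_sigma, mem_range, mem_Ico,
      Sigma.exists, Equiv.coe_toEmbedding, Equiv.sigmaEquivProd_apply, Prod.mk.injEq,
      extendBy]
    constructor
    · rintro ⟨h, h'⟩
      refine ⟨i, j, ⟨?_, ?_, h⟩, rfl, rfl⟩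
      · by_contra hi
        simp [h0 i (by omega)] at h
      · by_contra! hj
        rw [if_pos hj] at h'
        exact (hT.2 i j hj).ne h'
    · rintro ⟨i, j, ⟨-, h, h'⟩, rfl, rfl⟩
      simp [h', Nat.not_lt.mpr h]
  rw [contentCount, this, Set.ncard_coe_finset, card_map, card_sigma, sum_range_succ]
  simp [(mem_box.mp hμ).2 N le_rfl]

theorem sum_tableaux_eq_interlaceSum {R : Type*} [CommRing R] (x : ℕ → R) (N : ℕ) {ν : ℕ → ℕ}
    (hν : Antitone ν) (h0 : ∀ i, N ≤ i → ν i = 0) :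
    ∑ T ∈ (finite_tableaux N hν h0).toFinset, ∏ k ∈ range N, x k ^ contentCount ν T k =
      interlaceSum x N ν := by
  induction N generalizing ν with
  | zero =>
    have : (finite_tableaux 0 hν h0).toFinset = {fun _ _ => 0} := by
      ext T
      simp [tableaux, IsSSYT, h0, funext_iff]
    rw [this]
    simp [interlaceSum]
  | succ N ih =>
    rw [interlaceSum, ← sum_fiberwise_of_maps_to (g := lowerShape N ν)
      fun T hT => lowerShape_mem_box hν ((Set.Finite.mem_toFinset _).mp hT)]
    refine sum_congr rfl fun μ hμ => ?_
    have hle := le_of_mem_box hμ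
    rw [← ih (antitone_of_mem_box hμ) (mem_box.mp hμ).2, mul_sum]
    symm
    refine sum_nbij' (extendBy N μ ν) (restrictTo μ) ?_ ?_ ?_ ?_ ?_
    · intro T hT
      rw [Set.Finite.mem_toFinset] at hT
      simpa using ⟨extendBy_mem hν h0 hμ hT, lowerShape_extendBy hle hT⟩
    · intro T hT
      rw [mem_filter, Set.Finite.mem_toFinset] at hT
      obtain ⟨hT, rfl⟩ := hT
      simpa using restrictTo_mem hT.1
    · intro T hT
      rw [Set.Finite.mem_toFinset] at hT
      exact restrictTo_extendBy hT.1
    · intro T hT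
      rw [mem_filter, Set.Finite.mem_toFinset] at hT
      obtain ⟨hT, rfl⟩ := hT
      exact extendBy_restrictTo hT
    · intro T hT
      rw [Set.Finite.mem_toFinset] at hT
      rw [prod_range_succ, contentCount_extendBy_self h0 hμ hT, pow_add, prod_pow_eq_pow_sum,
        mul_comm]
      congr 1
      refine prod_congr rfl fun k hk => ?_
      rw [contentCount_extendBy_of_lt hle T (mem_range.mp hk)]

theorem schurPoly_eq_interlaceSum (R : Type) [CommRing R] {N : ℕ} {ν : ℕ → ℕ} (hν : Antitone ν)
    (h0 : ∀ i, N ≤ i → ν i = 0) :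
    schurPoly R N ν =
      interlaceSum (fun i => if h : i < N then (X ⟨i, h⟩ : MvPolynomial (Fin N) R) else 0) N ν := by
  rw [← sum_tableaux_eq_interlaceSum _ N hν h0, schurPoly, finsum_eq_sum_of_support_subset]
  · refine sum_congr rfl fun T hT => ?_
    rw [Set.Finite.mem_toFinset] at hT
    refine (if_pos hT).trans ?_
    rw [prod_range]
    simp
  · intro T hT
    rw [Function.mem_support, ne_eq, ite_eq_right_iff, Classical.not_imp] at hT
    exact mem_coe.mpr ((Set.Finite.mem_toFinset _).mpr hT.1)

theorem schurPoly_eq_zero (R : Type) [CommRing R] {N : ℕ} {ν : ℕ → ℕ} (hν : Antitone ν)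
    (hN : ν N ≠ 0) : schurPoly R N ν = 0 := by
  refine finsum_eq_zero_of_forall_eq_zero fun T => if_neg fun ⟨hT, h⟩ => ?_
  have hpos := Nat.pos_of_ne_zero hN
  exact (h N 0 hpos).not_ge (le_entry hν hT hpos)

theorem schurPoly_mul_esymm {N : ℕ} (n : ℕ) {lam : ℕ → ℕ} (hlam : Antitone lam)
    (h0 : ∀ i, N ≤ i → lam i = 0) :
    schurPoly ℤ N lam * esymm (Fin N) ℤ n =
      ∑ ν ∈ box N lam (fun i => lam i + 1),
        if n = ∑ i ∈ range N, (ν i - lam i) ∧ Antitone ν then schurPoly ℤ N ν else 0 := by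
  set y : ℕ → MvPolynomial (Fin N) ℤ := fun i => if h : i < N then X ⟨i, h⟩ else 0 with hy
  have key := congrArg (fun p => Polynomial.coeff p n)
    (interlaceSum_mul_prod (fun i => Polynomial.C (y i)) Polynomial.X N hlam h0)
  simp only [← map_interlaceSum, prod_pow_eq_pow_sum, Polynomial.finsetSum_coeff,
    Polynomial.coeff_C_mul, Polynomial.coeff_mul_C,
    Polynomial.coeff_X_pow] at key
  rw [schurPoly_eq_interlaceSum ℤ hlam h0, esymm]
  convert key using 2
  · rw [prod_range, prod_one_add, Polynomial.finsetSum_coeff, ← powerset_univ.symm,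
      powersetCard_eq_filter, sum_filter]
    refine sum_congr rfl fun s _ => ?_
    rw [prod_mul_distrib, prod_const, ← map_prod, Polynomial.coeff_mul_C, Polynomial.coeff_X_pow]
    simp [hy, eq_comm]
  · rename_i ν hν
    have hν0 := (mem_box.mp hν).2
    by_cases hanti : Antitone ν
    · simp [hanti, schurPoly_eq_interlaceSum ℤ hanti hν0, hy]
    · have : interlaceSum y N ν = 0 := by
        by_contra h
        exact hanti (antitone_of_interlaceSum_ne_zero hν0 h)
      simp [hanti, this]

theorem finsum_eq_sum_range {ν : ℕ → ℕ} {N : ℕ} (h0 : ∀ i, N ≤ i → ν i = 0) :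
    ∑ᶠ i, ν i = ∑ i ∈ range N, ν i :=
  finsum_eq_sum_of_support_subset _ fun i hi => by
    rw [mem_coe, mem_range]
    by_contra! h
    exact hi (h0 i h)

theorem stmt5 (N n : ℕ) (hN : 1 ≤ N) (lam : ℕ → ℕ) (hanti : Antitone lam)
    (hfin : ∃ M, ∀ i, M ≤ i → lam i = 0) :
    schurPoly ℤ N lam * MvPolynomial.esymm (Fin N) ℤ n
      = ∑ᶠ ν : ℕ → ℕ,
          if Antitone ν ∧ (∃ M, ∀ i, M ≤ i → ν i = 0) ∧ (∀ i, lam i ≤ ν i) ∧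
              (∑ᶠ i, ν i) = (∑ᶠ i, lam i) + n ∧ (∀ i, ν i ≤ lam i + 1)
          then schurPoly ℤ N ν else 0 := by
  by_cases hlamN : lam N = 0
  · have h0 (i) (hi : N ≤ i) : lam i = 0 := Nat.le_zero.mp (hlamN ▸ hanti hi)
    rw [schurPoly_mul_esymm n hanti h0,
      finsum_eq_sum_of_support_subset (s := box N lam fun i => lam i + 1)]
    · refine sum_congr rfl fun ν hν => ?_
      rw [mem_box] at hν
      refine if_congr ?_ rfl rfl
      have hle (i) : lam i ≤ ν i ∧ ν i ≤ lam i + 1 := by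
        rcases lt_or_ge i N with h | h
        · exact hν.1 i h
        · simp [h0 i h, hν.2 i h]
      have hsum : ∑ i ∈ range N, ν i =
          ∑ i ∈ range N, lam i + ∑ i ∈ range N, (ν i - lam i) := by
        rw [← sum_add_distrib]
        exact sum_congr rfl fun i _ => by have := hle i; omega
      rw [finsum_eq_sum_range h0, finsum_eq_sum_range hν.2, hsum, add_right_inj]
      exact ⟨fun h => ⟨h.2, ⟨N, hν.2⟩, fun i => (hle i).1, h.1.symm, fun i => (hle i).2⟩,
        fun h => ⟨h.2.2.2.1.symm, h.1⟩⟩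
    · intro ν hν
      rw [Function.mem_support, ne_eq, ite_eq_right_iff, Classical.not_imp] at hν
      obtain ⟨⟨hνa, -, h₁, -, h₂⟩, hne⟩ := hν
      have hνN : ν N = 0 := by
        by_contra h
        exact hne (schurPoly_eq_zero ℤ hνa h)
      exact mem_coe.mpr (mem_box.mpr
        ⟨fun i _ => ⟨h₁ i, h₂ i⟩, fun i hi => Nat.le_zero.mp (hνN ▸ hνa hi)⟩)
  · rw [schurPoly_eq_zero ℤ hanti hlamN, zero_mul]
    refine (finsum_eq_zero_of_forall_eq_zero fun ν => ?_).symm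
    refine ite_eq_right_iff.mpr fun h => schurPoly_eq_zero ℤ h.1 ?_
    have := h.2.2.1 N
    omega

end PlethysmSquare
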